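/- arXiv:2105.11135 — 4 statements merged into one kernel-verified Lean document; each statement's English description precedes it below -/
import Mathlib

section
/- Let V be a real linear space and R : V → ℝ∪{+∞} a sub-differentiable function. Let (h_t) be an arbitrary sequence with h_t ∈ dom R, let (α_t) be positive weights, and let h̄_t = (Σ_{i=1}^t α_i h_i)/α_{1:t}. Then for every reference point h* ∈ dom R and every T ≥ 1, and for any choice of sub-gradients in ∂R(h̄_t), the excess error satisfies the identity R(h̄_T) − R(h*) = (1/α_{1:T}) [ Σ_{t=1}^T α_t ( ⟨∂R(h̄_t), h_t − h*⟩ − B_R(h*; h̄_t) ) − Σ_{t=1}^{T−1} α_{1:t} B_R(h̄_t; h̄_{t+1}) ]. -/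
open Finset

/-- The sub-differential of `f : V → ℝ` at `x`: the set of continuous linear
functionals `g` such that `f u - f x ≥ ⟨g, u - x⟩` for all `u`. -/
def subdiff {V : Type*} [NormedAddCommGroup V] [NormedSpace ℝ V]
    (f : V → ℝ) (x : V) : Set (V →L[ℝ] ℝ) :=
  {g | ∀ u, g (u - x) ≤ f u - f x}

/-- One step of the weighted average: `α_{t+1} (h_{t+1} - h̄_{t+1}) = α_{1:t} (h̄_{t+1} - h̄_t)`. -/
theorem smul_sub_weightedAverage_succ
    {V : Type*} [AddCommGroup V] [Module ℝ V] {α : ℕ → ℝ} {h hbar : ℕ → V}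
    (hsmul : ∀ t, 1 ≤ t → (∑ i ∈ Icc 1 t, α i) • hbar t = ∑ i ∈ Icc 1 t, α i • h i)
    {t : ℕ} (ht : 1 ≤ t) :
    α (t + 1) • (h (t + 1) - hbar (t + 1)) =
      (∑ i ∈ Icc 1 t, α i) • (hbar (t + 1) - hbar t) := by
  have hsucc := hsmul (t + 1) (by lia)
  rw [sum_Icc_succ_top (by lia), sum_Icc_succ_top (by lia), ← hsmul t ht, add_smul] at hsucc
  rw [smul_sub, smul_sub, sub_eq_sub_iff_add_eq_add, add_comm, ← hsucc]

/-- Anytime lemma: for the weighted main iterates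
`h̄_t = (Σ_{i=1}^t α_i h_i)/α_{1:t}`, any reference point `h*`, and any choice of
sub-gradients `g t ∈ ∂R(h̄_t)`, we have the identity
`R(h̄_T) − R(h*) = (1/α_{1:T}) [ Σ_{t=1}^T α_t (⟨g_t, h_t − h*⟩ − B_R(h*; h̄_t))
  − Σ_{t=1}^{T−1} α_{1:t} B_R(h̄_t; h̄_{t+1}) ]`. -/
theorem anytime_lemma
    {V : Type*} [NormedAddCommGroup V] [NormedSpace ℝ V]
    (R : V → ℝ) (α : ℕ → ℝ) (h hbar : ℕ → V) (g : ℕ → V →L[ℝ] ℝ)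
    (hα : ∀ t, 1 ≤ t → 0 < α t)
    (hbar_def : ∀ t, 1 ≤ t →
      hbar t = (∑ i ∈ Icc 1 t, α i)⁻¹ • ∑ i ∈ Icc 1 t, α i • h i)
    (hg : ∀ t, 1 ≤ t → g t ∈ subdiff R (hbar t))
    (hstar : V) (T : ℕ) (hT : 1 ≤ T) :
    R (hbar T) - R hstar =
      (∑ t ∈ Icc 1 T, α t)⁻¹ *
        ((∑ t ∈ Icc 1 T, α t *
            ((g t) (h t - hstar) -
              (R hstar - R (hbar t) - (g t) (hstar - hbar t))))
          - ∑ t ∈ Icc 1 (T - 1), (∑ i ∈ Icc 1 t, α i) *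
              (R (hbar t) - R (hbar (t + 1)) -
                (g (t + 1)) (hbar t - hbar (t + 1)))) := by
  have hpos : ∀ t, 1 ≤ t → 0 < ∑ i ∈ Icc 1 t, α i := fun t ht =>
    sum_pos (fun i hi => hα i (mem_Icc.1 hi).1) ⟨1, mem_Icc.2 ⟨le_rfl, ht⟩⟩
  have hsmul : ∀ t, 1 ≤ t →
      (∑ i ∈ Icc 1 t, α i) • hbar t = ∑ i ∈ Icc 1 t, α i • h i := fun t ht => by
    rw [hbar_def t ht, smul_inv_smul₀ (hpos t ht).ne']
  rw [eq_inv_mul_iff_mul_eq₀ (hpos T hT).ne']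
  induction T, hT using Nat.le_induction with
  | base =>
    have h_one : hbar 1 = h 1 := by
      have := hsmul 1 le_rfl
      simpa [(hα 1 le_rfl).ne'] using this
    simp only [Icc_self, sum_singleton, h_one, map_sub, Nat.sub_self, Icc_eq_empty_of_lt one_pos,
      sum_empty]
    ring
  | succ t ht ih =>
    obtain ⟨s, rfl⟩ := Nat.exists_eq_add_of_le' ht
    have hstep := congrArg (g (s + 1 + 1)) (smul_sub_weightedAverage_succ hsmul ht)
    simp only [map_smul, map_sub, smul_eq_mul, Nat.add_sub_cancel] at hstep ih ⊢
    rw [sum_Icc_succ_top (b := s + 1) (by lia) α,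
      sum_Icc_succ_top (b := s + 1) (by lia) (fun t => α t * _),
      sum_Icc_succ_top (b := s) (by lia) (fun t => (∑ i ∈ Icc 1 t, α i) * _)]
    linear_combination ih - hstep
end

section
/- Let V be a reflexive real Banach space, H ⊂ V bounded, closed, and convex, Φ : V → ℝ differentiable, strictly convex, and σ-strongly convex on H with induced Bregman divergence D_Φ, R sub-differentiable with chosen sub-gradients g_t* ∈ ∂R(h̄_t), (Ḡ_t) ⊂ V* arbitrary, β_t > 0, and let h_{t+1} = argmin_{h∈H} [ ⟨Ḡ_t, h⟩ + (1/β_t) D_Φ(h; h_t) ]. Then for all t ≥ 1 and any reference point h* ∈ H, ⟨Ḡ_t, h_t − h*⟩ ≤ (D_Φ(h*; h_t) − D_Φ(h*; h_{t+1}))/β_t + (β_t/(2σ)) ‖g_t*‖_*² + ⟨g_t* − Ḡ_t, h_{t+1} − h_t⟩. -/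
/-- A function that is minimal over `[0, 1]` at `0` has nonnegative derivative there. -/
theorem HasDerivAt.nonneg_of_forall_le_on_Icc {q : ℝ → ℝ} {d : ℝ} (hq : HasDerivAt q d 0)
    (hmin : ∀ s ∈ Set.Icc (0 : ℝ) 1, q 0 ≤ q s) : 0 ≤ d := by
  have hloc : IsLocalMinOn q (Set.Icc 0 1) 0 := (isMinOn_iff.2 hmin).localize
  have hcone : (1 : ℝ) ∈ posTangentConeAt (Set.Icc (0 : ℝ) 1) 0 := by
    apply mem_posTangentConeAt_of_segment_subset
    rw [zero_add, segment_eq_Icc zero_le_one]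
  simpa using hloc.hasFDerivWithinAt_nonneg hq.hasFDerivAt.hasFDerivWithinAt hcone

/-- The derivative of a function along the line from `x` to `y`, at the starting point. -/
theorem HasFDerivAt.hasDerivAt_comp_line {V : Type*} [NormedAddCommGroup V] [NormedSpace ℝ V]
    {f : V → ℝ} {f' : V →L[ℝ] ℝ} {x : V} (hf : HasFDerivAt f f' x) (y : V) :
    HasDerivAt (fun s : ℝ => f (x + s • (y - x))) (f' (y - x)) 0 := by
  have hline : HasDerivAt (fun s : ℝ => x + s • (y - x)) (y - x) 0 := by
    simpa using ((hasDerivAt_id (0 : ℝ)).smul_const (y - x)).const_add x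
  exact HasFDerivAt.comp_hasDerivAt (0 : ℝ) (by simpa using hf) hline

/-- First-order optimality condition for minimization over a convex set. -/
theorem Convex.hasFDerivAt_sub_nonneg_of_isMinOn {V : Type*} [NormedAddCommGroup V]
    [NormedSpace ℝ V] {H : Set V} (hH : Convex ℝ H) {f : V → ℝ} {f' : V →L[ℝ] ℝ} {x y : V}
    (hf : HasFDerivAt f f' x) (hx : x ∈ H) (hmin : IsMinOn f H x) (hy : y ∈ H) :
    0 ≤ f' (y - x) := by
  refine (hf.hasDerivAt_comp_line y).nonneg_of_forall_le_on_Icc fun s hs => ?_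
  simpa using isMinOn_iff.1 hmin _ (hH.add_smul_sub_mem hx hy hs)

/-- First-order lower bound for a strongly convex function. -/
theorem StrongConvexOn.add_sq_norm_sub_le {V : Type*} [NormedAddCommGroup V]
    [NormedSpace ℝ V] {H : Set V} {σ : ℝ} {f : V → ℝ} {f' : V →L[ℝ] ℝ} {x y : V}
    (hconv : StrongConvexOn H σ f) (hf : HasFDerivAt f f' x) (hx : x ∈ H) (hy : y ∈ H) :
    σ / 2 * ‖y - x‖ ^ 2 ≤ f y - f x - f' (y - x) := by
  set c := σ / 2 * ‖y - x‖ ^ 2 with hc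
  have hid := hasDerivAt_id (0 : ℝ)
  have hq : HasDerivAt (fun s : ℝ => f x + s * (f y - f x) - s * (1 - s) * c
      - f (x + s • (y - x))) (f y - f x - c - f' (y - x)) 0 := by
    refine ((((hid.mul_const (f y - f x)).const_add (f x)).sub
      ((hid.mul (hid.const_sub 1)).mul_const c)).sub
        (hf.hasDerivAt_comp_line y)).congr_deriv ?_
    simp
  have := hq.nonneg_of_forall_le_on_Icc fun s hs => by
    have h2 := hconv.2 hy hx hs.1 (sub_nonneg.2 hs.2) (add_sub_cancel s 1)
    have hpt : s • y + (1 - s) • x = x + s • (y - x) := by module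
    simp only [hpt, smul_eq_mul, ← hc] at h2
    simp only [zero_smul, add_zero, zero_mul, sub_zero, sub_self]
    linarith
  linarith

/-- Young's inequality for the duality pairing. -/
theorem ContinuousLinearMap.neg_apply_le_sq_norm_add_sq_norm {V : Type*} [NormedAddCommGroup V]
    [NormedSpace ℝ V] (g : V →L[ℝ] ℝ) (v : V) {c : ℝ} (hc : 0 < c) :
    -g v ≤ 1 / (2 * c) * ‖g‖ ^ 2 + c / 2 * ‖v‖ ^ 2 := by
  have h1 : -g v ≤ ‖g‖ * ‖v‖ := (neg_le_abs _).trans (g.le_opNorm v)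
  have h2 : 1 / (2 * c) * ‖g‖ ^ 2 + c / 2 * ‖v‖ ^ 2 - ‖g‖ * ‖v‖
      = (‖g‖ - c * ‖v‖) ^ 2 / (2 * c) := by
    field_simp
    ring
  have h3 : 0 ≤ (‖g‖ - c * ‖v‖) ^ 2 / (2 * c) := by positivity
  linarith

/-- anytime robust SMD, one-step regret bound: for the mirror
descent update `h_{t+1} = argmin_{h∈H} [⟨Ḡ_t, h⟩ + (1/β_t) D_Φ(h; h_t)]` with
`Φ` differentiable, strictly convex and `σ`-strongly convex on `H`, and chosen
sub-gradients `g_t ∈ ∂R(h̄_t)`, for all `t ≥ 1` and any `h* ∈ H`: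
`⟨Ḡ_t, h_t − h*⟩ ≤ (D_Φ(h*; h_t) − D_Φ(h*; h_{t+1}))/β_t
  + (β_t/(2σ))‖g_t‖_*² + ⟨g_t − Ḡ_t, h_{t+1} − h_t⟩`. -/
theorem anytime_robust_smd_regret
    {V : Type*} [NormedAddCommGroup V] [NormedSpace ℝ V] [CompleteSpace V]
    (H : Set V) (hH : Convex ℝ H) (hHc : IsClosed H)
    (hHb : Bornology.IsBounded H)
    (R : V → ℝ)
    (Φ : V → ℝ) (gradΦ : V → V →L[ℝ] ℝ)
    (hΦd : ∀ x, HasFDerivAt Φ (gradΦ x) x)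
    (hΦstrict : StrictConvexOn ℝ Set.univ Φ)
    (σ : ℝ) (hσ : 0 < σ) (hΦstrong : StrongConvexOn H σ Φ)
    (D : V → V → ℝ)
    (hD : ∀ u v, D u v = Φ u - Φ v - (gradΦ v) (u - v))
    (β : ℕ → ℝ) (hβ : ∀ t, 1 ≤ t → 0 < β t)
    (Gbar : ℕ → V →L[ℝ] ℝ)
    (hbar h : ℕ → V) (g : ℕ → V →L[ℝ] ℝ)
    (hg : ∀ t, 1 ≤ t → g t ∈ subdiff R (hbar t))
    (h1H : h 1 ∈ H)
    (hupdate : ∀ t, 1 ≤ t → h (t + 1) ∈ H ∧ ∀ w ∈ H,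
      (Gbar t) (h (t + 1)) + (1 / β t) * D (h (t + 1)) (h t) ≤
        (Gbar t) w + (1 / β t) * D w (h t))
    (t : ℕ) (ht : 1 ≤ t) (hstar : V) (hstarH : hstar ∈ H) :
    (Gbar t) (h t - hstar) ≤
      (D hstar (h t) - D hstar (h (t + 1))) / β t
        + (β t / (2 * σ)) * ‖g t‖ ^ 2
        + (g t - Gbar t) (h (t + 1) - h t) := by
  have hβt := hβ t ht
  have hx : h t ∈ H := by
    obtain rfl | ht' := ht.eq_or_lt
    · exact h1H
    · obtain ⟨n, rfl⟩ := Nat.exists_eq_add_of_lt ht'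
      exact (hupdate (1 + n) (by omega)).1
  obtain ⟨hy, hmin⟩ := hupdate t ht
  generalize h (t + 1) = y at *
  generalize h t = x at *
  have hderiv : HasFDerivAt (fun w => Gbar t w + (1 / β t) * D w x)
      (Gbar t + (1 / β t) • (gradΦ y - gradΦ x)) y := by
    simp only [hD]
    refine (Gbar t).hasFDerivAt.add (HasFDerivAt.const_mul ?_ _)
    exact ((hΦd y).sub_const _).sub
      ((gradΦ x).hasFDerivAt.comp y ((hasFDerivAt_id y).sub_const x))
  have hopt := hH.hasFDerivAt_sub_nonneg_of_isMinOn hderiv hy (isMinOn_iff.2 hmin) hstarH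
  have hbreg := hΦstrong.add_sq_norm_sub_le (hΦd x) hx hy
  have hyoung := (g t).neg_apply_le_sq_norm_add_sq_norm (y - x) (div_pos hσ hβt)
  have hbreg' := mul_le_mul_of_nonneg_left hbreg (one_div_pos.2 hβt).le
  have e1 : 1 / (2 * (σ / β t)) = β t / (2 * σ) := by field_simp
  have e2 : σ / β t / 2 * ‖y - x‖ ^ 2 = 1 / β t * (σ / 2 * ‖y - x‖ ^ 2) := by field_simp
  rw [e1, e2] at hyoung
  simp only [hD, div_eq_mul_one_div (_ - _) (β t), add_apply,
    sub_apply, smul_apply, smul_eq_mul, map_sub]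
    at hopt hbreg' hyoung ⊢
  linarith
end

section
/- Let V be a real normed linear space, R : V → ℝ convex and γ-smooth, ψ : V → ℝ a σ_ψ-strongly convex function, α > 0 and A > 0 constants with (γ/σ_ψ) α² ≤ A, and points h, h′, h̄, h̄′ ∈ V. Then α ⟨∇R(h̄) − ∇R(h̄′), h − h′⟩ − B_ψ(h′; h) ≤ A · B_R(h̄′; h̄), where B_f(u; v) := f(u) − f(v) − ⟨∂f(v), u − v⟩. (In the AO-FTRL analysis this is applied with α = α_t, A = α_{1:(t−1)}, h = h_t, h′ = h_{t+1}, h̄ = h̄_t, h̄′ = h̄_{t−1}.) -/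
/-- The first-order lower bound for a convex differentiable function. -/
theorem ConvexOn.add_hasFDerivAt_le {V : Type*} [NormedAddCommGroup V] [NormedSpace ℝ V]
    {f : V → ℝ} (hf : ConvexOn ℝ Set.univ f) {f' : V →L[ℝ] ℝ} {x : V}
    (hf' : HasFDerivAt f f' x) (y : V) : f x + f' (y - x) ≤ f y := by
  have hline : ConvexOn ℝ Set.univ (f ∘ AffineMap.lineMap (k := ℝ) x y) := by
    simpa using hf.comp_affineMap (AffineMap.lineMap (k := ℝ) x y)
  have hderiv : HasDerivAt (f ∘ AffineMap.lineMap (k := ℝ) x y) (f' (y - x)) 0 := by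
    refine HasFDerivAt.comp_hasDerivAt (0 : ℝ) ?_ AffineMap.hasDerivAt_lineMap
    simpa using hf'
  have hslope := hline.le_slope_of_hasDerivAt (Set.mem_univ 0) (Set.mem_univ 1) one_pos hderiv
  simp only [slope_def_field, Function.comp_apply, AffineMap.lineMap_apply_one,
    AffineMap.lineMap_apply_zero, sub_zero, div_one] at hslope
  linarith

/-- The descent lemma: a function with `γ`-Lipschitz derivative is bounded above by its
first-order expansion plus `γ / 2 * ‖e‖ ^ 2`. -/
theorem le_add_half_mul_norm_sq_of_lipschitz_fderiv
    {V : Type*} [NormedAddCommGroup V] [NormedSpace ℝ V]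
    {f : V → ℝ} {f' : V → V →L[ℝ] ℝ} {γ : ℝ} (hf' : ∀ x, HasFDerivAt f (f' x) x)
    (hlip : ∀ x y, ‖f' x - f' y‖ ≤ γ * ‖x - y‖) (x e : V) :
    f (x + e) ≤ f x + f' x e + γ / 2 * ‖e‖ ^ 2 := by
  have hderiv (t : ℝ) : HasDerivAt
      (fun t : ℝ => f (x + t • e) - t * f' x e - γ / 2 * ‖e‖ ^ 2 * t ^ 2)
      (f' (x + t • e) e - f' x e - γ * ‖e‖ ^ 2 * t) t := by
    have hline : HasDerivAt (fun t : ℝ => x + t • e) e t := by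
      simpa using ((hasDerivAt_id t).smul_const e).const_add x
    have hf := (hf' (x + t • e)).comp_hasDerivAt t hline
    refine ((hf.sub ((hasDerivAt_id t).mul_const (f' x e))).sub
      ((hasDerivAt_pow 2 t).const_mul (γ / 2 * ‖e‖ ^ 2))).congr_deriv ?_
    push_cast
    ring
  have hanti : AntitoneOn
      (fun t : ℝ => f (x + t • e) - t * f' x e - γ / 2 * ‖e‖ ^ 2 * t ^ 2) (Set.Icc 0 1) := by
    refine antitoneOn_of_hasDerivWithinAt_nonpos (convex_Icc 0 1)
      (fun t _ => (hderiv t).continuousAt.continuousWithinAt)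
      (fun t _ => (hderiv t).hasDerivWithinAt) fun t ht => ?_
    rw [interior_Icc] at ht
    have hnorm : ‖f' (x + t • e) - f' x‖ ≤ γ * (t * ‖e‖) := by
      simpa [norm_smul, abs_of_pos ht.1] using hlip (x + t • e) x
    have hbound : (f' (x + t • e) - f' x) e ≤ γ * (t * ‖e‖) * ‖e‖ :=
      (le_abs_self _).trans ((f' (x + t • e) - f' x).le_of_opNorm_le hnorm e)
    rw [sub_apply] at hbound
    linarith
  have hle := hanti (Set.left_mem_Icc.2 zero_le_one) (Set.right_mem_Icc.2 zero_le_one) zero_le_one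
  simp only [one_smul, zero_smul, add_zero] at hle
  linarith

/-- The quadratic lower bound for a strongly convex function with a given sub-gradient. -/
theorem StrongConvexOn.half_mul_norm_sq_le_of_mem_subdiff
    {V : Type*} [NormedAddCommGroup V] [NormedSpace ℝ V]
    {f : V → ℝ} {σ : ℝ} (hf : StrongConvexOn Set.univ σ f) {x : V} {g : V →L[ℝ] ℝ}
    (hg : g ∈ subdiff f x) (y : V) : σ / 2 * ‖y - x‖ ^ 2 ≤ f y - f x - g (y - x) := by
  have hmid (t : ℝ) (ht₀ : 0 < t) (ht₁ : t < 1) :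
      (1 - t) * (σ / 2 * ‖y - x‖ ^ 2) ≤ f y - f x - g (y - x) := by
    have hconv := hf.2 (Set.mem_univ y) (Set.mem_univ x) ht₀.le (sub_nonneg.2 ht₁.le)
      (add_sub_cancel t 1)
    have hsub := hg (t • y + (1 - t) • x)
    have hpoint : t • y + (1 - t) • x - x = t • (y - x) := by module
    rw [hpoint, map_smul] at hsub
    simp only [smul_eq_mul] at hconv hsub
    refine le_of_mul_le_mul_left ?_ ht₀
    linarith
  have hnonneg : 0 ≤ f y - f x - g (y - x) := sub_nonneg.2 (hg y)
  by_contra! hlt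
  set c := σ / 2 * ‖y - x‖ ^ 2
  set d := f y - f x - g (y - x)
  have hc : 0 < c := hnonneg.trans_lt hlt
  have hle := hmid ((c - d) / (2 * c)) (div_pos (sub_pos.2 hlt) (by positivity))
    ((div_lt_one (by positivity)).2 (by linarith))
  have heq : (1 - (c - d) / (2 * c)) * c = (c + d) / 2 := by
    field_simp
    ring
  linarith

/-- helper inequality for the AO-FTRL analysis: for convex
`γ`-smooth `R`, a `σ_ψ`-strongly convex `ψ`, constants `α, A > 0` with
`(γ/σ_ψ)α² ≤ A`, and any points `h, h′, h̄, h̄′`,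
`α⟨∇R(h̄) − ∇R(h̄′), h − h′⟩ − B_ψ(h′; h) ≤ A·B_R(h̄′; h̄)` where
`B_f(u; v) = f(u) − f(v) − ⟨∂f(v), u − v⟩` (with a chosen sub-gradient for `ψ`). -/
theorem aoftrl_smoothness_helper
    {V : Type*} [NormedAddCommGroup V] [NormedSpace ℝ V]
    (R : V → ℝ) (gradR : V → V →L[ℝ] ℝ) (γ : ℝ)
    (hconv : ConvexOn ℝ Set.univ R)
    (hderiv : ∀ x, HasFDerivAt R (gradR x) x)
    (hsmooth : ∀ x y, ‖gradR x - gradR y‖ ≤ γ * ‖x - y‖)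
    (ψ : V → ℝ) (σψ : ℝ) (hσψ : 0 < σψ)
    (hψ : StrongConvexOn Set.univ σψ ψ)
    (α A : ℝ) (hα : 0 < α) (hA : 0 < A)
    (hweights : (γ / σψ) * α ^ 2 ≤ A)
    (h h' hb hb' : V) (gψ : V →L[ℝ] ℝ) (hgψ : gψ ∈ subdiff ψ h) :
    α * ((gradR hb - gradR hb') (h - h')) - (ψ h' - ψ h - gψ (h' - h))
      ≤ A * (R hb' - R hb - (gradR hb) (hb' - hb)) := by
  have hψ_lower := hψ.half_mul_norm_sq_le_of_mem_subdiff hgψ h'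
  rw [norm_sub_rev] at hψ_lower
  have hupper := le_add_half_mul_norm_sq_of_lipschitz_fderiv hderiv hsmooth hb' ((α / A) • (h - h'))
  have hlower := hconv.add_hasFDerivAt_le (hderiv hb) (hb' + (α / A) • (h - h'))
  rw [add_sub_right_comm, map_add, map_smul, smul_eq_mul] at hlower
  rw [map_smul, smul_eq_mul, norm_smul, mul_pow, Real.norm_eq_abs, sq_abs] at hupper
  rw [sub_apply]
  have hγ : γ * α ^ 2 / A ≤ σψ := by
    rw [div_mul_eq_mul_div, div_le_iff₀ hσψ] at hweights
    rw [div_le_iff₀ hA]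
    linarith
  have hquad : γ * α ^ 2 / A * ‖h - h'‖ ^ 2 ≤ σψ * ‖h - h'‖ ^ 2 :=
    mul_le_mul_of_nonneg_right hγ (sq_nonneg _)
  have hscaled := mul_le_mul_of_nonneg_left (hlower.trans hupper) hA.le
  have hlin (r : ℝ) : A * (α / A * r) = α * r := by field_simp
  have hsq : A * (γ / 2 * ((α / A) ^ 2 * ‖h - h'‖ ^ 2)) =
      γ * α ^ 2 / A * ‖h - h'‖ ^ 2 / 2 := by field_simp
  simp only [mul_add, hlin, hsq] at hscaled
  linarith
end

section
/- Let V be a real normed linear space and let f : V → ℝ∪{+∞} be σ-strongly convex with respect to ‖·‖ for some σ > 0. Then for any u, v ∈ dom f and any sub-gradients g_u ∈ ∂f(u), g_v ∈ ∂f(v), it holds that f(u) − f(v) ≤ ⟨g_v, u − v⟩ + (1/(2σ)) ‖g_u − g_v‖_*². -/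
/-- A sub-gradient of a strongly convex function gives a quadratic lower bound. -/
lemma StrongConvexOn.add_sq_le_of_mem_subdiff
    {V : Type*} [NormedAddCommGroup V] [NormedSpace ℝ V] {f : V → ℝ} {σ : ℝ}
    (hf : StrongConvexOn Set.univ σ f) {x : V} {g : V →L[ℝ] ℝ} (hg : g ∈ subdiff f x) (y : V) :
    g (y - x) + σ / 2 * ‖x - y‖ ^ 2 ≤ f y - f x := by
  have hbound : ∀ a ∈ Set.Ioo (0 : ℝ) 1,
      g (y - x) + (1 - a) * (σ / 2 * ‖x - y‖ ^ 2) ≤ f y - f x := by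
    rintro a ⟨ha₀, ha₁⟩
    have hconv := hf.2 (Set.mem_univ x) (Set.mem_univ y) (sub_nonneg.2 ha₁.le) ha₀.le
      (sub_add_cancel 1 a)
    have hsub := hg ((1 - a) • x + a • y)
    have heq : (1 - a) • x + a • y - x = a • (y - x) := by module
    rw [heq, map_smul] at hsub
    simp only [smul_eq_mul] at hconv hsub
    refine le_of_mul_le_mul_left ?_ ha₀
    linarith
  have hlim : Filter.Tendsto (fun a : ℝ => g (y - x) + (1 - a) * (σ / 2 * ‖x - y‖ ^ 2))
      (nhdsWithin 0 (Set.Ioi 0)) (nhds (g (y - x) + (1 - 0) * (σ / 2 * ‖x - y‖ ^ 2))) :=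
    (Continuous.tendsto (by fun_prop) 0).mono_left nhdsWithin_le_nhds
  rw [sub_zero, one_mul] at hlim
  refine le_of_tendsto hlim ?_
  filter_upwards [Ioo_mem_nhdsGT (zero_lt_one' ℝ)] with a ha using hbound a ha

/-- duality of strong convexity and smoothness: if `f` is
`σ`-strongly convex, then for any `u, v` and sub-gradients `g_u ∈ ∂f(u)`,
`g_v ∈ ∂f(v)` we have `f(u) − f(v) ≤ ⟨g_v, u − v⟩ + (1/(2σ))‖g_u − g_v‖_*²`. -/
theorem strong_convexity_smoothness_duality
    {V : Type*} [NormedAddCommGroup V] [NormedSpace ℝ V]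
    (f : V → ℝ) (σ : ℝ) (hσ : 0 < σ)
    (hf : StrongConvexOn Set.univ σ f)
    (u v : V) (gu gv : V →L[ℝ] ℝ)
    (hgu : gu ∈ subdiff f u) (hgv : gv ∈ subdiff f v) :
    f u - f v ≤ gv (u - v) + (1 / (2 * σ)) * ‖gu - gv‖ ^ 2 := by
  have hquad := hf.add_sq_le_of_mem_subdiff hgu v
  have hneg : gu (v - u) = -gu (u - v) := by rw [← map_neg, neg_sub]
  have hop : gu (u - v) - gv (u - v) ≤ ‖gu - gv‖ * ‖u - v‖ :=
    (le_abs_self _).trans ((gu - gv).le_opNorm (u - v))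
  have hyoung : ‖gu - gv‖ * ‖u - v‖ - σ / 2 * ‖u - v‖ ^ 2 ≤ 1 / (2 * σ) * ‖gu - gv‖ ^ 2 := by
    have hsq : 0 ≤ 1 / (2 * σ) * (‖gu - gv‖ - σ * ‖u - v‖) ^ 2 := by positivity
    have hexp : 1 / (2 * σ) * (‖gu - gv‖ - σ * ‖u - v‖) ^ 2 =
        1 / (2 * σ) * ‖gu - gv‖ ^ 2 - (‖gu - gv‖ * ‖u - v‖ - σ / 2 * ‖u - v‖ ^ 2) := by
      field_simp
      ring
    linarith
  linarith
end
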